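/- Let (R, m) be a local ring with infinite residue field and let {I_n} be a filtration of ideals of R with dim R/I_n = dim R/I_1 for all n ≥ 1. Then the limit c = lim_{n→∞} r(R/I_n)/n exists, and r(R/I_n) ≥ c·n − 1 for all n ≥ 1. -/

import Mathlib

namespace CMReg

section Reduction

variable {A : Type} [CommRing A]

/-- `q` is a reduction of the ideal `M` (i.e. `M^(s+1) = q * M^s` for some `s`). -/
def IsReduction (M q : Ideal A) : Prop :=
  q ≤ M ∧ ∃ s : ℕ, M ^ (s + 1) = q * M ^ s

/-- The reduction number of `A` with respect to the reduction `q` of `M`. -/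
noncomputable def redIdx (M q : Ideal A) : ℕ :=
  sInf {s : ℕ | M ^ (s + 1) = q * M ^ s}

/-- A minimal reduction: a reduction containing no other reduction. -/
def IsMinReduction (M q : Ideal A) : Prop :=
  IsReduction M q ∧ ∀ q' ≤ q, IsReduction M q' → q' = q

/-- The reduction number `r(A)` of a local ring `A` with maximal ideal `M`:
the minimum of the reduction numbers with respect to minimal reductions of `M`. -/
noncomputable def locRedNum (M : Ideal A) : ℕ :=
  sInf {s : ℕ | ∃ q : Ideal A, IsMinReduction M q ∧ redIdx M q = s}

/-- `V` (with `M² ≤ V ≤ M`, encoding the space `V/M²` of linear forms of the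
associated graded ring `G(A) = ⊕ Mⁿ/Mⁿ⁺¹`) generates a reduction of `G(A)`:
the ideal `J` of `G(A)` generated by the degree-one part `V/M²` satisfies
`Jₙ = G(A)ₙ` for all large `n`. -/
def IsGReduction (M V : Ideal A) : Prop :=
  M ^ 2 ≤ V ∧ V ≤ M ∧ ∃ n₀ : ℕ, ∀ s ≥ n₀, M ^ (s + 1) ≤ V * M ^ s ⊔ M ^ (s + 2)

/-- The reduction number of the associated graded ring `G(A)` with respect to the
graded reduction determined by `V`. -/
noncomputable def gRedIdx (M V : Ideal A) : ℕ :=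
  sInf {n₀ : ℕ | ∀ s ≥ n₀, M ^ (s + 1) ≤ V * M ^ s ⊔ M ^ (s + 2)}

/-- Minimal graded reduction of the associated graded ring. -/
def IsMinGReduction (M V : Ideal A) : Prop :=
  IsGReduction M V ∧ ∀ V' : Ideal A, M ^ 2 ≤ V' → V' ≤ V → IsGReduction M V' → V' = V

/-- The reduction number `r(G(A))` of the associated graded ring of `A` with respect
to the ideal `M` (minimum of reduction numbers over minimal graded reductions). -/
noncomputable def gRedNumAssocGraded (M : Ideal A) : ℕ :=
  sInf {s : ℕ | ∃ V : Ideal A, IsMinGReduction M V ∧ gRedIdx M V = s}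

end Reduction

end CMReg

open CMReg IsLocalRing Filter Topology

namespace CMReg

theorem span_range_pow_le_span_sym_prod {A : Type*} [CommRing A] {ι : Type*} (y : ι → A) (n : ℕ) :
    Ideal.span (Set.range y) ^ n ≤
      Ideal.span (Set.range fun β : Sym ι n => ((β : Multiset ι).map y).prod) := by
  induction n with
  | zero =>
    rw [pow_zero, Ideal.one_eq_top, top_le_iff, Ideal.eq_top_iff_one]
    exact Ideal.subset_span ⟨Sym.nil, by simp⟩
  | succ n ih =>
    rw [pow_succ]
    refine (Ideal.mul_mono_left ih).trans ?_
    rw [Ideal.span_mul_span', Ideal.span_le]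
    rintro _ ⟨_, ⟨β, rfl⟩, _, ⟨i, rfl⟩, rfl⟩
    exact Ideal.subset_span ⟨Sym.cons i β, by simp [Sym.coe_cons, mul_comm]⟩

theorem pow_succ_le_mul_pow_sup_span {A : Type*} [CommRing A] {Q Q' : Ideal A} {y : A}
    (hy : y ∈ Q) (hQ : Q ≤ Q' ⊔ Ideal.span {y}) (n : ℕ) :
    Q ^ (n + 1) ≤ Q' * Q ^ n ⊔ Ideal.span {y ^ (n + 1)} := by
  induction n with
  | zero => simpa using hQ
  | succ n ih =>
    have hyn : Ideal.span {y ^ (n + 1)} ≤ Q ^ (n + 1) :=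
      (Ideal.span_singleton_le_iff_mem _).2 (Ideal.pow_mem_pow hy _)
    calc Q ^ (n + 1 + 1) = Q * Q ^ (n + 1) := pow_succ' _ _
      _ ≤ Q * (Q' * Q ^ n ⊔ Ideal.span {y ^ (n + 1)}) := Ideal.mul_mono_right ih
      _ = Q' * Q ^ (n + 1) ⊔ Q * Ideal.span {y ^ (n + 1)} := by
        rw [Ideal.mul_sup, pow_succ' Q n, mul_left_comm]
      _ ≤ Q' * Q ^ (n + 1) ⊔ (Q' ⊔ Ideal.span {y}) * Ideal.span {y ^ (n + 1)} :=
        sup_le_sup_left (Ideal.mul_mono_left hQ) _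
      _ ≤ _ := by
        rw [Ideal.sup_mul, Ideal.span_singleton_mul_span_singleton, ← pow_succ' y]
        exact sup_le le_sup_left
          (sup_le ((Ideal.mul_mono_right hyn).trans le_sup_left) le_sup_right)

theorem prod_map_mem_pow_card {A : Type*} [CommRing A] {ι : Type*} {Q : Ideal A}
    {f : ι → A} (hf : ∀ i, f i ∈ Q) (α : Multiset ι) : (α.map f).prod ∈ Q ^ α.card := by
  induction α using Multiset.induction with
  | empty => simp
  | cons i α ih =>
    rw [Multiset.map_cons, Multiset.prod_cons, Multiset.card_cons, pow_succ']
    exact Ideal.mul_mem_mul (hf i) ih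

theorem prod_map_sub_prod_map_mem {A : Type*} [CommRing A] {ι : Type*} {Q Q' : Ideal A}
    {f g : ι → A} (hf : ∀ i, f i ∈ Q) (hg : ∀ i, g i ∈ Q) (hfg : ∀ i, f i - g i ∈ Q')
    (n : ℕ) (α : Multiset ι) (hα : α.card = n + 1) :
    (α.map f).prod - (α.map g).prod ∈ Q' * Q ^ n := by
  induction n generalizing α with
  | zero =>
    obtain ⟨i, rfl⟩ := Multiset.card_eq_one.1 hα
    simpa using hfg i
  | succ n ih =>
    obtain ⟨i, β, rfl, hβ⟩ := Multiset.card_eq_succ_iff.1 hα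
    have hgβ : (β.map g).prod ∈ Q ^ (n + 1) := by
      simpa [hβ] using prod_map_mem_pow_card hg β
    have key : (f i * (β.map f).prod - g i * (β.map g).prod) =
        f i * ((β.map f).prod - (β.map g).prod) + (f i - g i) * (β.map g).prod := by ring
    rw [Multiset.map_cons, Multiset.map_cons, Multiset.prod_cons, Multiset.prod_cons, key]
    refine add_mem ?_ (Ideal.mul_mem_mul (hfg i) hgβ)
    rw [pow_succ' Q n, mul_left_comm]
    exact Ideal.mul_mem_mul (hf i) (ih β hβ)

theorem exists_multichoose_gt (C ℓ : ℕ) :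
    ∃ N, ∀ n ≥ N, C * Nat.multichoose ℓ n < Nat.multichoose (ℓ + 1) n := by
  refine ⟨C * ℓ + 1, fun n hn => ?_⟩
  rcases ℓ with _ | ℓ
  · obtain ⟨n, rfl⟩ : ∃ k, n = k + 1 := ⟨n - 1, by omega⟩
    simp
  · have h1 : (ℓ + 1) * Nat.multichoose (ℓ + 1 + 1) n =
        (n + (ℓ + 1)) * Nat.multichoose (ℓ + 1) n := by
      rw [Nat.multichoose_eq, Nat.multichoose_eq]
      have h := Nat.add_one_mul_choose_eq (ℓ + n) ℓ
      have e1 : ℓ + 1 + 1 + n - 1 = ℓ + n + 1 := by omega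
      have e2 : ℓ + 1 + n - 1 = ℓ + n := by omega
      rw [e1, e2, ← Nat.choose_symm_of_eq_add (show ℓ + n + 1 = (ℓ + 1) + n by omega),
        ← Nat.choose_symm_of_eq_add (show ℓ + n = ℓ + n from rfl)]
      linarith
    have h0 : 0 < Nat.multichoose (ℓ + 1) n := by
      rw [Nat.multichoose_eq]; exact Nat.choose_pos (by omega)
    have h2 : (ℓ + 1) * (C * Nat.multichoose (ℓ + 1) n) <
        (n + (ℓ + 1)) * Nat.multichoose (ℓ + 1) n := by
      rw [← mul_assoc]
      refine Nat.mul_lt_mul_of_pos_right ?_ h0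
      nlinarith
    rw [← h1] at h2
    exact Nat.lt_of_mul_lt_mul_left h2

theorem pow_add_le_pow_mul_pow {A : Type*} [CommRing A] {M q : Ideal A} {s : ℕ}
    (h : M ^ (s + 1) ≤ q * M ^ s) (n : ℕ) : M ^ (n + s) ≤ q ^ n * M ^ s := by
  induction n with
  | zero => simp
  | succ n ih =>
    calc M ^ (n + 1 + s) = M ^ (n + s) * M := by rw [← pow_succ]; ring_nf
      _ ≤ q ^ n * M ^ s * M := Ideal.mul_mono_left ih
      _ = q ^ n * M ^ (s + 1) := by rw [mul_assoc, ← pow_succ]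
      _ ≤ q ^ n * (q * M ^ s) := Ideal.mul_mono_right h
      _ = _ := by rw [← mul_assoc, pow_succ]

section Local

variable {A : Type*} [CommRing A] [IsLocalRing A]

theorem exists_unit_relation {ι κ : Type*} [Fintype ι] [Fintype κ] {u : ι → A} {g : κ → A}
    (B : ι → κ → A) (hu : ∀ i, ∑ k, B i k * g k = u i)
    (hB : ¬ LinearIndependent (ResidueField A) fun i k => residue A (B i k)) :
    ∃ c : ι → A, (∃ i, IsUnit (c i)) ∧
      ∑ i, c i * u i ∈ maximalIdeal A * Ideal.span (Set.range g) := by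
  obtain ⟨d, hd, i₀, hi₀⟩ := Fintype.not_linearIndependent_iff.1 hB
  choose c hc using fun i => residue_surjective (d i)
  refine ⟨c, ⟨i₀, (residue_ne_zero_iff_isUnit _).1 (by rwa [hc])⟩, ?_⟩
  have : ∑ i, c i * u i = ∑ k, (∑ i, c i * B i k) * g k := by
    simp_rw [← hu, Finset.mul_sum, Finset.sum_mul]
    rw [Finset.sum_comm]
    simp_rw [mul_assoc]
  rw [this]
  refine sum_mem fun k _ => Ideal.mul_mem_mul ?_ (Ideal.subset_span ⟨k, rfl⟩)
  rw [← residue_eq_zero_iff, map_sum]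
  simpa [hc] using congrFun hd k

theorem pow_succ_eq_of_le_sup [IsNoetherianRing A] {q : Ideal A} (hq : q ≤ maximalIdeal A) {s : ℕ}
    (h : maximalIdeal A ^ (s + 1) ≤ q * maximalIdeal A ^ s ⊔ maximalIdeal A ^ (s + 2)) :
    maximalIdeal A ^ (s + 1) = q * maximalIdeal A ^ s := by
  refine le_antisymm ?_ (by rw [pow_succ']; exact Ideal.mul_mono_left hq)
  refine Submodule.le_of_le_smul_of_le_jacobson_bot (I := maximalIdeal A)
    (IsNoetherian.noetherian _) (maximalIdeal_le_jacobson _) ?_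
  rwa [smul_eq_mul, ← pow_succ']

/-- More elements than the number of generators of some reduction satisfy a homogeneous relation
modulo the maximal ideal. -/
theorem exists_homogeneous_relation [IsNoetherianRing A] {ℓ v s : ℕ} (hv : ℓ < v) {y : Fin ℓ → A}
    (hys : maximalIdeal A ^ (s + 1) ≤ Ideal.span (Set.range y) * maximalIdeal A ^ s)
    (hy : ∀ i, y i ∈ maximalIdeal A)
    {x : Fin v → A} (hx : ∀ i, x i ∈ maximalIdeal A) :
    ∃ (n : ℕ) (c : Sym (Fin v) (n + 1) → A), (∃ α, IsUnit (c α)) ∧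
      ∑ α, c α * ((α : Multiset (Fin v)).map x).prod ∈ maximalIdeal A ^ (n + 2) := by
  obtain ⟨C, g, hg⟩ := Submodule.fg_iff_exists_fin_generating_family.1
    (IsNoetherian.noetherian (maximalIdeal A ^ s))
  obtain ⟨N, hN⟩ := exists_multichoose_gt C ℓ
  set n := N + s with hn
  let h : Sym (Fin ℓ) (N + 1) × Fin C → A :=
    fun p => ((p.1 : Multiset (Fin ℓ)).map y).prod * g p.2
  have hspan : maximalIdeal A ^ (n + 1) ≤ Ideal.span (Set.range h) := by
    have h1 := pow_add_le_pow_mul_pow hys (N + 1)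
    rw [show n + 1 = N + 1 + s by omega]
    refine h1.trans ((Ideal.mul_mono_left (span_range_pow_le_span_sym_prod _ _)).trans ?_)
    rw [← hg]
    change Ideal.span _ * Ideal.span _ ≤ _
    rw [Ideal.span_mul_span', Ideal.span_le]
    rintro _ ⟨_, ⟨β, rfl⟩, _, ⟨i, rfl⟩, rfl⟩
    exact Ideal.subset_span ⟨(β, i), rfl⟩
  have hspan' : Ideal.span (Set.range h) ≤ maximalIdeal A ^ (n + 1) := by
    rw [Ideal.span_le]
    rintro _ ⟨⟨β, i⟩, rfl⟩
    rw [show n + 1 = N + 1 + s by omega, pow_add]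
    refine Ideal.mul_mem_mul ?_ (hg ▸ Submodule.subset_span ⟨i, rfl⟩)
    simpa using prod_map_mem_pow_card hy (β : Multiset (Fin ℓ))
  have hmem : ∀ α : Sym (Fin v) (n + 1), ∃ b : Sym (Fin ℓ) (N + 1) × Fin C → A,
      ∑ k, b k * h k = ((α : Multiset (Fin v)).map x).prod := by
    intro α
    have := hspan (by simpa using prod_map_mem_pow_card hx (α : Multiset (Fin v)))
    simpa using (Submodule.mem_span_range_iff_exists_fun A).1 this
  choose B hB using hmem
  obtain ⟨c, hc, hrel⟩ := exists_unit_relation B hB (by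
    intro hli
    have := hli.fintype_card_le_finrank
    rw [Module.finrank_fintype_fun_eq_card, Fintype.card_prod, Sym.card_sym_eq_multichoose,
      Sym.card_sym_eq_multichoose, Fintype.card_fin, Fintype.card_fin, Fintype.card_fin] at this
    have h1 := hN (n + 1) (by omega)
    have h2 : Nat.multichoose (ℓ + 1) (n + 1) ≤ Nat.multichoose v (n + 1) := by
      rw [Nat.multichoose_eq, Nat.multichoose_eq]
      exact Nat.choose_le_choose _ (by omega)
    have h3 : Nat.multichoose ℓ (N + 1) ≤ Nat.multichoose ℓ (n + 1) := by
      rcases ℓ with _ | ℓ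
      · simp
      · rw [Nat.multichoose_eq, Nat.multichoose_eq,
          ← Nat.choose_symm_of_eq_add (show ℓ + 1 + (N + 1) - 1 = ℓ + (N + 1) by omega),
          ← Nat.choose_symm_of_eq_add (show ℓ + 1 + (n + 1) - 1 = ℓ + (n + 1) by omega)]
        exact Nat.choose_le_choose _ (by omega)
    have h4 := Nat.mul_le_mul_left C h3
    rw [mul_comm] at this
    omega)
  refine ⟨n, c, hc, ?_⟩
  rw [show n + 2 = (n + 1) + 1 by rfl, pow_succ']
  exact Ideal.mul_mono_right hspan' hrel

end Local

theorem exists_eval_ne_zero_of_coeff_ne_zero {k : Type*} [Field k] [Infinite k] {ι : Type*}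
    [Fintype ι] [DecidableEq ι] {n : ℕ} (c : Sym ι n → k) (hc : ∃ α, c α ≠ 0) :
    ∃ a : ι → k, ∑ α, c α * ((α : Multiset ι).map a).prod ≠ 0 := by
  let P : MvPolynomial ι k :=
    ∑ α : Sym ι n, MvPolynomial.monomial (Multiset.toFinsupp (α : Multiset ι)) (c α)
  have hP : P ≠ 0 := by
    obtain ⟨α, hα⟩ := hc
    intro h
    apply hα
    have h1 := congrArg (MvPolynomial.coeff (Multiset.toFinsupp (α : Multiset ι))) h
    simpa [P, MvPolynomial.coeff_sum, MvPolynomial.coeff_monomial, Sym.coe_inj] using h1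
  by_contra! h
  refine hP (MvPolynomial.funext fun a => ?_)
  rw [map_zero, ← h a, map_sum]
  exact Finset.sum_congr rfl fun (α : Sym ι n) _ => by
    rw [MvPolynomial.eval_monomial, Finsupp.prod, Finset.prod_multiset_map_count]
    rfl

section Reductions

variable {A : Type} [CommRing A] [IsLocalRing A] [IsNoetherianRing A]

theorem isReduction_of_le_sup {q : Ideal A} (hq : q ≤ maximalIdeal A) {s : ℕ}
    (h : maximalIdeal A ^ (s + 1) ≤ q * maximalIdeal A ^ s ⊔ maximalIdeal A ^ (s + 2)) :
    IsReduction (maximalIdeal A) q :=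
  ⟨hq, s, pow_succ_eq_of_le_sup hq h⟩

theorem exists_isReduction_le_of_lt [Infinite (ResidueField A)] {ℓ v : ℕ} (hv : ℓ < v + 1)
    {y : Fin ℓ → A} (hy : IsReduction (maximalIdeal A) (Ideal.span (Set.range y)))
    {x : Fin (v + 1) → A} (hx : IsReduction (maximalIdeal A) (Ideal.span (Set.range x))) :
    ∃ z : Fin v → A, Ideal.span (Set.range z) ≤ Ideal.span (Set.range x) ∧
      IsReduction (maximalIdeal A) (Ideal.span (Set.range z)) := by
  obtain ⟨hyM, t, hyt⟩ := hy
  obtain ⟨hxM, s, hxs⟩ := hx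
  obtain ⟨n, c, ⟨α₀, hα₀⟩, hrel⟩ := exists_homogeneous_relation hv hyt.le
    (fun i => hyM (Ideal.subset_span ⟨i, rfl⟩)) (fun i => hxM (Ideal.subset_span ⟨i, rfl⟩))
  obtain ⟨abar, habar⟩ := exists_eval_ne_zero_of_coeff_ne_zero (fun α => residue A (c α))
    ⟨α₀, (residue_ne_zero_iff_isUnit _).2 hα₀⟩
  choose a ha using fun i => residue_surjective (abar i)
  set e := ∑ α, c α * ((α : Multiset (Fin (v + 1))).map a).prod with he
  have hue : IsUnit e := by
    rw [← residue_ne_zero_iff_isUnit]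
    have : residue A e = ∑ α : Sym (Fin (v + 1)) (n + 1), residue A (c α) *
        ((α : Multiset (Fin (v + 1))).map abar).prod := by
      simp [he, map_multiset_prod, ha]
    rwa [this]
  obtain ⟨j, hj⟩ : ∃ j, IsUnit (a j) := by
    by_contra! h
    have hm : ∀ i, a i ∈ maximalIdeal A := fun i => h i
    refine (mem_maximalIdeal e).1 ?_ hue
    refine sum_mem fun α _ => Ideal.mul_mem_left _ _ ?_
    have := prod_map_mem_pow_card hm (α : Multiset (Fin (v + 1)))
    rw [Sym.card_coe] at this
    exact Ideal.pow_le_self (Nat.succ_ne_zero n) this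
  let Q := Ideal.span (Set.range x)
  let z : Fin v → A := fun i => a j * x (j.succAbove i) - a (j.succAbove i) * x j
  let Q' := Ideal.span (Set.range z)
  have hxQ : ∀ i, x i ∈ Q := fun i => Ideal.subset_span ⟨i, rfl⟩
  have hdiff : ∀ i, a j * x i - a i * x j ∈ Q' := by
    intro i
    rcases Fin.eq_self_or_eq_succAbove j i with rfl | ⟨i, rfl⟩
    · simp
    · exact Ideal.subset_span ⟨i, rfl⟩
  have hQ'Q : Q' ≤ Q := by
    rw [Ideal.span_le]
    rintro _ ⟨i, rfl⟩
    exact sub_mem (Ideal.mul_mem_left _ _ (hxQ _)) (Ideal.mul_mem_left _ _ (hxQ _))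
  have hQle : Q ≤ Q' ⊔ Ideal.span {x j} := by
    rw [Ideal.span_le]
    rintro _ ⟨i, rfl⟩
    refine (Ideal.unit_mul_mem_iff_mem _ hj).1 ?_
    rw [← sub_add_cancel (a j * x i) (a i * x j)]
    exact Submodule.add_mem_sup (hdiff i) (Ideal.mul_mem_left _ _ (Ideal.subset_span rfl))
  have hxj : x j ^ (n + 1) ∈ Q' * Q ^ n ⊔ maximalIdeal A ^ (n + 2) := by
    refine (Ideal.unit_mul_mem_iff_mem _ hue).1 ?_
    have hdecomp : e * x j ^ (n + 1) =
        -(∑ α : Sym (Fin (v + 1)) (n + 1), c α *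
          (((α : Multiset (Fin (v + 1))).map fun i => a j * x i).prod -
            ((α : Multiset (Fin (v + 1))).map fun i => a i * x j).prod)) +
        a j ^ (n + 1) * ∑ α, c α * ((α : Multiset (Fin (v + 1))).map x).prod := by
      simp only [Multiset.prod_map_mul, Multiset.map_const', Multiset.prod_replicate,
        Sym.card_coe, mul_sub, Finset.sum_sub_distrib, he, Finset.sum_mul, Finset.mul_sum]
      rw [neg_sub, sub_add, ← Finset.sum_sub_distrib]
      rw [Finset.sum_eq_zero (s := Finset.univ) (f := fun α => _ - _), sub_zero]
      · exact Finset.sum_congr rfl fun _ _ => by ring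
      · intros; ring
    rw [hdecomp]
    refine Submodule.add_mem_sup (neg_mem (sum_mem fun α _ => Ideal.mul_mem_left _ _ ?_))
      (Ideal.mul_mem_left _ _ hrel)
    exact prod_map_sub_prod_map_mem (fun i => Ideal.mul_mem_left _ _ (hxQ i))
      (fun i => Ideal.mul_mem_left _ _ (hxQ j)) hdiff n _ (Sym.card_coe)
  refine ⟨z, hQ'Q, isReduction_of_le_sup (hQ'Q.trans hxM) (s := n + s) ?_⟩
  have hQn : Q ^ (n + 1) ≤ Q' * Q ^ n ⊔ maximalIdeal A ^ (n + 2) :=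
    (pow_succ_le_mul_pow_sup_span (hxQ j) hQle n).trans
      (sup_le le_sup_left ((Ideal.span_singleton_le_iff_mem _).2 hxj))
  calc maximalIdeal A ^ (n + s + 1) = maximalIdeal A ^ (n + 1 + s) := by ring_nf
    _ ≤ Q ^ (n + 1) * maximalIdeal A ^ s := pow_add_le_pow_mul_pow hxs.le _
    _ ≤ (Q' * Q ^ n ⊔ maximalIdeal A ^ (n + 2)) * maximalIdeal A ^ s := Ideal.mul_mono_left hQn
    _ ≤ Q' * maximalIdeal A ^ (n + s) ⊔ maximalIdeal A ^ (n + s + 2) := by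
      rw [Ideal.sup_mul, mul_assoc, ← pow_add, show n + 2 + s = n + s + 2 by ring, pow_add _ n s]
      exact sup_le_sup_right (Ideal.mul_mono_right (Ideal.mul_mono_left
        (Ideal.pow_right_mono hxM n))) _

variable (A) in
/-- The maximal ideal of `A` has a reduction generated by `v` elements. -/
def HasReductionOfLength (v : ℕ) : Prop :=
  ∃ x : Fin v → A, IsReduction (maximalIdeal A) (Ideal.span (Set.range x))

variable (A) in
theorem exists_hasReductionOfLength : ∃ v, HasReductionOfLength A v := by
  obtain ⟨v, x, hx⟩ := Submodule.fg_iff_exists_fin_generating_family.1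
    (IsNoetherian.noetherian (maximalIdeal A))
  refine ⟨v, x, ?_⟩
  change Ideal.span _ = _ at hx
  rw [hx]
  exact ⟨le_rfl, 0, by simp⟩

variable (A) in
open Classical in
/-- The analytic spread of the maximal ideal: the least number of generators of a reduction. -/
noncomputable def spread : ℕ := Nat.find (exists_hasReductionOfLength A)

theorem hasReductionOfLength_spread : HasReductionOfLength A (spread A) := by
  classical exact Nat.find_spec (exists_hasReductionOfLength A)

theorem spread_le {v : ℕ} (h : HasReductionOfLength A v) : spread A ≤ v := by
  classical exact Nat.find_min' _ h

theorem exists_isReduction_le_of_spread [Infinite (ResidueField A)] {q : Ideal A}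
    (hq : IsReduction (maximalIdeal A) q) :
    ∃ z : Fin (spread A) → A, Ideal.span (Set.range z) ≤ q ∧
      IsReduction (maximalIdeal A) (Ideal.span (Set.range z)) := by
  classical
  have hex : ∃ v, ∃ z : Fin v → A, Ideal.span (Set.range z) ≤ q ∧
      IsReduction (maximalIdeal A) (Ideal.span (Set.range z)) := by
    obtain ⟨v, x, hx⟩ := Submodule.fg_iff_exists_fin_generating_family.1
      (IsNoetherian.noetherian q)
    change Ideal.span _ = _ at hx
    exact ⟨v, x, hx.le, by rwa [hx]⟩
  obtain ⟨z, hzq, hz⟩ := Nat.find_spec hex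
  have heq : Nat.find hex = spread A := by
    refine le_antisymm ?_ (spread_le ⟨z, hz⟩)
    by_contra! hlt
    obtain ⟨w, hw⟩ : ∃ w, Nat.find hex = w + 1 := ⟨Nat.find hex - 1, by omega⟩
    obtain ⟨y, hy⟩ := hasReductionOfLength_spread (A := A)
    have hz' : ∃ z : Fin (w + 1) → A, Ideal.span (Set.range z) ≤ q ∧
        IsReduction (maximalIdeal A) (Ideal.span (Set.range z)) := hw ▸ Nat.find_spec hex
    obtain ⟨z', hzq', hz'⟩ := hz'
    obtain ⟨z'', h1, h2⟩ := exists_isReduction_le_of_lt (by omega) hy hz'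
    exact Nat.find_min hex (by omega : w < _) ⟨z'', h1.trans hzq', h2⟩
  rw [← heq]
  exact ⟨z, hzq, hz⟩

theorem exists_eq_span_of_isMinReduction [Infinite (ResidueField A)] {q : Ideal A}
    (hq : IsMinReduction (maximalIdeal A) q) :
    ∃ z : Fin (spread A) → A, Ideal.span (Set.range z) = q := by
  obtain ⟨z, hz, hzr⟩ := exists_isReduction_le_of_spread hq.1
  exact ⟨z, hq.2 _ hz hzr⟩

theorem span_eq_of_le_of_spread {x z : Fin (spread A) → A}
    (hz : IsReduction (maximalIdeal A) (Ideal.span (Set.range z)))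
    (hx : IsReduction (maximalIdeal A) (Ideal.span (Set.range x)))
    (hzx : Ideal.span (Set.range z) ≤ Ideal.span (Set.range x)) :
    Ideal.span (Set.range z) = Ideal.span (Set.range x) := by
  have hmem : ∀ i, ∃ b : Fin (spread A) → A, ∑ k, b k * x k = z i := fun i => by
    simpa using (Submodule.mem_span_range_iff_exists_fun A).1 (hzx (Ideal.subset_span ⟨i, rfl⟩))
  choose B hB using hmem
  by_cases hdet : IsUnit (Matrix.det (Matrix.of B))
  · refine le_antisymm hzx ?_
    rw [Ideal.span_le]
    rintro _ ⟨k, rfl⟩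
    have h1 : (Matrix.of B).mulVec x = z := funext hB
    have h2 : (Matrix.of B)⁻¹.mulVec z = x := by
      rw [← h1, Matrix.mulVec_mulVec, Matrix.nonsing_inv_mul _ hdet, Matrix.one_mulVec]
    rw [← h2]
    change ∑ i, (Matrix.of B)⁻¹ k i * z i ∈ Ideal.span (Set.range z)
    exact sum_mem fun i _ => Ideal.mul_mem_left _ _ (Ideal.subset_span ⟨i, rfl⟩)
  · exfalso
    obtain ⟨c, ⟨j, hj⟩, hc⟩ := exists_unit_relation B hB (by
      have h0 : Matrix.det ((residue A).mapMatrix (Matrix.of B)) = 0 := by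
        rw [← RingHom.map_det, residue_eq_zero_iff]
        exact hdet
      intro hli
      have := (Matrix.linearIndependent_rows_iff_isUnit
        (A := (residue A).mapMatrix (Matrix.of B))).1 hli
      rw [Matrix.isUnit_iff_isUnit_det, h0] at this
      exact not_isUnit_zero this)
    obtain ⟨w, hw⟩ : ∃ w, spread A = w + 1 := ⟨spread A - 1, by have := j.2; omega⟩
    obtain ⟨hzM, s, hs⟩ := hz
    have hzi : ∀ i, z i ∈ maximalIdeal A := fun i => hzM (Ideal.subset_span ⟨i, rfl⟩)
    let z' : Fin w → A := fun i => z (Fin.cast hw.symm ((Fin.cast hw j).succAbove i))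
    have hz'M : Ideal.span (Set.range z') ≤ maximalIdeal A := by
      rw [Ideal.span_le]
      rintro _ ⟨i, rfl⟩
      exact hzi _
    have hz' : ∀ i, i ≠ j → z i ∈ Ideal.span (Set.range z') := by
      intro i hij
      obtain ⟨i', hi'⟩ := Fin.exists_succAbove_eq
        (show Fin.cast hw i ≠ Fin.cast hw j from fun h => hij (Fin.cast_injective _ h))
      exact Ideal.subset_span ⟨i', by simp [z', hi']⟩
    have hle : Ideal.span (Set.range z) ≤ Ideal.span (Set.range z') ⊔ maximalIdeal A ^ 2 := by
      rw [Ideal.span_le]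
      rintro _ ⟨i, rfl⟩
      by_cases hij : i = j
      · subst hij
        refine (Ideal.unit_mul_mem_iff_mem _ hj).1 ?_
        rw [← Finset.add_sum_erase _ _ (Finset.mem_univ i)] at hc
        rw [← add_sub_cancel_right (c i * z i) (∑ k ∈ Finset.univ.erase i, c k * z k), sub_eq_add_neg,
          add_comm]
        refine Submodule.add_mem_sup (neg_mem (sum_mem fun k hk => Ideal.mul_mem_left _ _
          (hz' k (Finset.ne_of_mem_erase hk)))) ?_
        rw [pow_two]
        exact Ideal.mul_mono_right hx.1 hc
      · exact Ideal.mem_sup_left (hz' i hij)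
    have hred : IsReduction (maximalIdeal A) (Ideal.span (Set.range z')) := by
      refine isReduction_of_le_sup hz'M (s := s) ?_
      rw [hs, show s + 2 = 2 + s by ring, pow_add, ← Ideal.sup_mul]
      exact Ideal.mul_mono_left hle
    have := spread_le ⟨z', hred⟩
    omega

theorem isMinReduction_span_of_spread [Infinite (ResidueField A)] {x : Fin (spread A) → A}
    (hx : IsReduction (maximalIdeal A) (Ideal.span (Set.range x))) :
    IsMinReduction (maximalIdeal A) (Ideal.span (Set.range x)) := by
  refine ⟨hx, fun q' hq' hq'r => le_antisymm hq' ?_⟩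
  obtain ⟨z, hzq, hz⟩ := exists_isReduction_le_of_spread hq'r
  rwa [span_eq_of_le_of_spread hz hx (hzq.trans hq')] at hzq

theorem locRedNum_le_of_spread [Infinite (ResidueField A)] {x : Fin (spread A) → A}
    (hx : Ideal.span (Set.range x) ≤ maximalIdeal A) {s : ℕ}
    (hs : maximalIdeal A ^ (s + 1) ≤ Ideal.span (Set.range x) * maximalIdeal A ^ s) :
    locRedNum (maximalIdeal A) ≤ s := by
  have heq : maximalIdeal A ^ (s + 1) = Ideal.span (Set.range x) * maximalIdeal A ^ s :=
    pow_succ_eq_of_le_sup hx (hs.trans le_sup_left)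
  have hmem : redIdx (maximalIdeal A) (Ideal.span (Set.range x)) ∈ {s : ℕ | ∃ q : Ideal A,
      IsMinReduction (maximalIdeal A) q ∧ redIdx (maximalIdeal A) q = s} :=
    ⟨_, isMinReduction_span_of_spread ⟨hx, s, heq⟩, rfl⟩
  exact (Nat.sInf_le hmem).trans (Nat.sInf_le heq)

variable (A) in
theorem exists_span_of_locRedNum [Infinite (ResidueField A)] :
    ∃ x : Fin (spread A) → A, Ideal.span (Set.range x) ≤ maximalIdeal A ∧
      maximalIdeal A ^ (locRedNum (maximalIdeal A) + 1) =
        Ideal.span (Set.range x) * maximalIdeal A ^ locRedNum (maximalIdeal A) := by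
  obtain ⟨y, hy⟩ := hasReductionOfLength_spread (A := A)
  obtain ⟨q, hq, hqr⟩ : locRedNum (maximalIdeal A) ∈ {s : ℕ | ∃ q : Ideal A,
      IsMinReduction (maximalIdeal A) q ∧ redIdx (maximalIdeal A) q = s} :=
    Nat.sInf_mem ⟨_, _, isMinReduction_span_of_spread hy, rfl⟩
  obtain ⟨x, rfl⟩ := exists_eq_span_of_isMinReduction hq
  refine ⟨x, hq.1.1, ?_⟩
  rw [← hqr]
  exact Nat.sInf_mem (s := {s : ℕ | maximalIdeal A ^ (s + 1) =
    Ideal.span (Set.range x) * maximalIdeal A ^ s}) hq.1.2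

end Reductions

section Relative

theorem pow_add_le_mul_pow_sup {A : Type*} [CommRing A] {M Q I J K : Ideal A} {s t : ℕ}
    (hQ : Q ≤ M) (hI : M ^ (s + 1) ≤ Q * M ^ s ⊔ I) (hJ : M ^ (t + 1) ≤ Q * M ^ t ⊔ J)
    (hK : I * J ≤ K) : M ^ (s + t + 1 + 1) ≤ Q * M ^ (s + t + 1) ⊔ K := by
  have hQt : Q * M ^ t ≤ M ^ (t + 1) := by
    rw [pow_succ']; exact Ideal.mul_mono_left hQ
  have hJ' : M ^ (t + 1) ≤ Q * M ^ t ⊔ J ⊓ M ^ (t + 1) := by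
    rw [← sup_inf_assoc_of_le _ hQt]
    exact le_inf hJ le_rfl
  have h1 : M ^ (s + 1) * (Q * M ^ t) ≤ Q * M ^ (s + t + 1) := by
    rw [mul_left_comm, ← pow_add, show s + 1 + t = s + t + 1 by ring]
  have h2 : Q * M ^ s * (J ⊓ M ^ (t + 1)) ≤ Q * M ^ (s + t + 1) := by
    rw [add_assoc, pow_add M s, ← mul_assoc]
    exact Ideal.mul_mono_right inf_le_right
  have h3 : I * (J ⊓ M ^ (t + 1)) ≤ K := (Ideal.mul_mono_right inf_le_left).trans hK
  calc M ^ (s + t + 1 + 1) = M ^ (s + 1) * M ^ (t + 1) := by rw [← pow_add]; ring_nf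
    _ ≤ M ^ (s + 1) * (Q * M ^ t ⊔ J ⊓ M ^ (t + 1)) := Ideal.mul_mono_right hJ'
    _ = M ^ (s + 1) * (Q * M ^ t) ⊔ M ^ (s + 1) * (J ⊓ M ^ (t + 1)) := Ideal.mul_sup _ _ _
    _ ≤ M ^ (s + 1) * (Q * M ^ t) ⊔ (Q * M ^ s ⊔ I) * (J ⊓ M ^ (t + 1)) :=
      sup_le_sup_left (Ideal.mul_mono_left hI) _
    _ ≤ _ := by
      rw [Ideal.sup_mul]
      exact sup_le (h1.trans le_sup_left)
        (sup_le (h2.trans le_sup_left) (h3.trans le_sup_right))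

variable {R : Type*} [CommRing R] [IsLocalRing R] [IsNoetherianRing R]

open Polynomial in
theorem exists_polynomial_forall_pow_le {ι : Type*} [Fintype ι] {I : Ideal R} {x y : ι → R} {s : ℕ}
    (hx : maximalIdeal R ^ (s + 1) ≤ Ideal.span (Set.range x) * maximalIdeal R ^ s ⊔ I)
    (hy : ∀ i, y i ∈ maximalIdeal R) :
    ∃ p : (ResidueField R)[X], p ≠ 0 ∧ ∀ t : R, p.eval (residue R t) ≠ 0 →
      maximalIdeal R ^ (s + 1) ≤
        Ideal.span (Set.range fun i => x i + t * y i) * maximalIdeal R ^ s ⊔ I := by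
  obtain ⟨C, g, hg⟩ := Submodule.fg_iff_exists_fin_generating_family.1
    (IsNoetherian.noetherian (maximalIdeal R ^ (s + 1)))
  have hgm : ∀ j, g j ∈ maximalIdeal R ^ (s + 1) := fun j => hg ▸ Submodule.subset_span ⟨j, rfl⟩
  have hdec : ∀ j, ∃ l : ι → R, (∀ i, l i ∈ maximalIdeal R ^ s) ∧
      g j - ∑ i, l i * x i ∈ I := by
    intro j
    obtain ⟨a, ha, e, he, hae⟩ := Submodule.mem_sup.1 (hx (hgm j))
    rw [mul_comm, ← smul_eq_mul, Ideal.span,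
      Submodule.mem_ideal_smul_span_iff_exists_sum] at ha
    obtain ⟨l, hl, hla⟩ := ha
    refine ⟨l, hl, ?_⟩
    rw [Finsupp.sum_fintype _ _ (by simp)] at hla
    simp only [smul_eq_mul] at hla
    rw [hla, ← hae, add_sub_cancel_left]
    exact he
  choose l hl hle using hdec
  have hB : ∀ j, ∃ b : Fin C → R, ∑ k, b k * g k = - ∑ i, l j i * y i := by
    intro j
    have : - ∑ i, l j i * y i ∈ Submodule.span R (Set.range g) := by
      rw [hg, pow_succ]
      exact neg_mem (sum_mem fun i _ => Ideal.mul_mem_mul (hl j i) (hy i))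
    simpa using (Submodule.mem_span_range_iff_exists_fun R).1 this
  choose B hB using hB
  let D : Matrix (Fin C) (Fin C) R := Matrix.of B
  refine ⟨((residue R).mapMatrix D).charpolyRev, fun h => ?_, fun t ht => ?_⟩
  · have h1 := Matrix.eval_charpolyRev (M := (residue R).mapMatrix D)
    rw [h, eval_zero] at h1
    exact zero_ne_one h1
  have hdet : residue R (1 - t • D).det =
      (((residue R).mapMatrix D).charpolyRev).eval (residue R t) := by
    rw [Matrix.charpolyRev, ← coe_evalRingHom, RingHom.map_det, RingHom.map_det]
    congr 1
    ext i j
    rcases eq_or_ne i j with hij | hij <;> simp [hij] <;> exact mul_comm _ _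
  have hunit : IsUnit (1 - t • D).det := by
    rw [← residue_ne_zero_iff_isUnit, hdet]
    exact ht
  have hmem : ∀ j, (1 - t • D).mulVec g j ∈
      Ideal.span (Set.range fun i => x i + t * y i) * maximalIdeal R ^ s ⊔ I := by
    intro j
    have : (1 - t • D).mulVec g j =
        ∑ i, (x i + t * y i) * l j i + (g j - ∑ i, l j i * x i) := by
      have h1 : (D.mulVec g) j = - ∑ i, l j i * y i := hB j
      rw [Matrix.sub_mulVec, Matrix.one_mulVec, Matrix.smul_mulVec, Pi.sub_apply, Pi.smul_apply,
        h1]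
      simp only [add_mul, Finset.sum_add_distrib, smul_eq_mul, mul_neg, Finset.mul_sum]
      rw [Finset.sum_congr rfl fun i _ => mul_comm (x i) (l j i),
        Finset.sum_congr rfl fun i _ => show t * y i * l j i = t * (l j i * y i) by ring]
      ring
    rw [this]
    exact Submodule.add_mem_sup (sum_mem fun i _ => Ideal.mul_mem_mul
      (Ideal.subset_span ⟨i, rfl⟩) (hl j i)) (hle j)
  rw [← hg, Submodule.span_le]
  rintro _ ⟨k, rfl⟩
  have h2 : (1 - t • D)⁻¹.mulVec ((1 - t • D).mulVec g) = g := by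
    rw [Matrix.mulVec_mulVec, Matrix.nonsing_inv_mul _ hunit, Matrix.one_mulVec]
  rw [← congrFun h2 k]
  change ∑ j, (1 - t • D)⁻¹ k j * (1 - t • D).mulVec g j ∈
    Ideal.span (Set.range fun i => x i + t * y i) * maximalIdeal R ^ s ⊔ I
  exact sum_mem fun j _ => Ideal.mul_mem_left _ _ (hmem j)

theorem exists_common_pow_le [Infinite (ResidueField R)] {ι : Type*} [Fintype ι] {I J : Ideal R}
    {x y : ι → R} {s t : ℕ} (hxm : ∀ i, x i ∈ maximalIdeal R) (hym : ∀ i, y i ∈ maximalIdeal R)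
    (hx : maximalIdeal R ^ (s + 1) ≤ Ideal.span (Set.range x) * maximalIdeal R ^ s ⊔ I)
    (hy : maximalIdeal R ^ (t + 1) ≤ Ideal.span (Set.range y) * maximalIdeal R ^ t ⊔ J) :
    ∃ z : ι → R, (∀ i, z i ∈ maximalIdeal R) ∧
      maximalIdeal R ^ (s + 1) ≤ Ideal.span (Set.range z) * maximalIdeal R ^ s ⊔ I ∧
      maximalIdeal R ^ (t + 1) ≤ Ideal.span (Set.range z) * maximalIdeal R ^ t ⊔ J := by
  obtain ⟨p, hp, hpx⟩ := exists_polynomial_forall_pow_le hx hym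
  obtain ⟨p', hp', hpy⟩ := exists_polynomial_forall_pow_le hy hxm
  have hfin : ({τ | p.IsRoot τ} ∪ {τ | p'.IsRoot τ⁻¹} ∪ {0}).Finite :=
    ((Polynomial.finite_setOfPred_isRoot hp).union
      ((Polynomial.finite_setOfPred_isRoot hp').preimage inv_injective.injOn)).union
      (Set.finite_singleton 0)
  obtain ⟨τ, hτ⟩ := hfin.infinite_compl.nonempty
  simp only [Set.mem_compl_iff, Set.mem_union, Set.mem_ofPred_eq, Set.mem_singleton_iff,
    not_or] at hτ
  obtain ⟨⟨h1, h2⟩, h0⟩ := hτ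
  obtain ⟨r, rfl⟩ := residue_surjective τ
  obtain ⟨u, rfl⟩ := (residue_ne_zero_iff_isUnit _).1 h0
  refine ⟨fun i => x i + u * y i, fun i => add_mem (hxm i) (Ideal.mul_mem_left _ _ (hym i)),
    hpx _ h1, ?_⟩
  have hu : residue R ((u⁻¹ : Rˣ) : R) = (residue R (u : R))⁻¹ := by
    refine eq_inv_of_mul_eq_one_left ?_
    rw [← map_mul, Units.inv_mul, map_one]
  refine (hpy ((u⁻¹ : Rˣ) : R) (by rwa [hu])).trans
    (sup_le_sup_right (Ideal.mul_mono_left ?_) _)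
  rw [Ideal.span_le]
  rintro _ ⟨i, rfl⟩
  have : y i + ((u⁻¹ : Rˣ) : R) * x i = ((u⁻¹ : Rˣ) : R) * (x i + u * y i) := by
    rw [mul_add, Units.inv_mul_cancel_left, add_comm]
  simp only [this]
  exact Ideal.mul_mem_left _ _ (Ideal.subset_span ⟨i, rfl⟩)

end Relative

section Quotient

theorem map_pow_le_iff {R : Type*} [CommRing R] {I Q M : Ideal R} {s : ℕ} :
    M.map (Ideal.Quotient.mk I) ^ (s + 1) ≤
        Q.map (Ideal.Quotient.mk I) * M.map (Ideal.Quotient.mk I) ^ s ↔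
      M ^ (s + 1) ≤ Q * M ^ s ⊔ I := by
  rw [← Ideal.map_pow, ← Ideal.map_pow, ← Ideal.map_mul, Ideal.map_le_iff_le_comap,
    Ideal.comap_map_of_surjective _ Ideal.Quotient.mk_surjective, ← RingHom.ker_eq_comap_bot,
    Ideal.mk_ker]

theorem map_span_range {R : Type*} [CommRing R] {I : Ideal R} {ι : Type*} (x : ι → R) :
    (Ideal.span (Set.range x)).map (Ideal.Quotient.mk I) =
      Ideal.span (Set.range fun i => Ideal.Quotient.mk I (x i)) := by
  rw [Ideal.map_span, ← Set.range_comp]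
  rfl

theorem infinite_residueField_quotient {R : Type*} [CommRing R] [IsLocalRing R]
    [Infinite (ResidueField R)] (I : Ideal R) [IsLocalRing (R ⧸ I)] :
    Infinite (ResidueField (R ⧸ I)) := by
  have := IsLocalHom.of_surjective (Ideal.Quotient.mk I) Ideal.Quotient.mk_surjective
  exact Infinite.of_injective _ (ResidueField.map (Ideal.Quotient.mk I)).injective

variable {R : Type} [CommRing R] [IsLocalRing R] [IsNoetherianRing R]

theorem hasReductionOfLength_quotient_iff {I : Ideal R} [IsLocalRing (R ⧸ I)] {v : ℕ} :
    HasReductionOfLength (R ⧸ I) v ↔ ∃ (x : Fin v → R) (s : ℕ), (∀ i, x i ∈ maximalIdeal R) ∧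
      maximalIdeal R ^ (s + 1) ≤ Ideal.span (Set.range x) * maximalIdeal R ^ s ⊔ I := by
  have := IsLocalHom.of_surjective (Ideal.Quotient.mk I) Ideal.Quotient.mk_surjective
  have hmap := map_maximalIdeal_of_surjective _ (Ideal.Quotient.mk_surjective (I := I))
  constructor
  · rintro ⟨x, hx, s, hs⟩
    choose y hy using fun i => Ideal.Quotient.mk_surjective (x i)
    refine ⟨y, s, fun i => ?_, ?_⟩
    · rw [← maximalIdeal_comap (Ideal.Quotient.mk I), Ideal.mem_comap, hy]
      exact hx (Ideal.subset_span ⟨i, rfl⟩)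
    · rw [← map_pow_le_iff, hmap, map_span_range]
      simp only [hy]
      exact hs.le
  · rintro ⟨y, s, hy, hs⟩
    have hle : Ideal.span (Set.range fun i => Ideal.Quotient.mk I (y i)) ≤
        maximalIdeal (R ⧸ I) := by
      rw [← map_span_range, ← hmap]
      exact Ideal.map_mono (Ideal.span_le.2 (Set.range_subset_iff.2 hy))
    refine ⟨fun i => Ideal.Quotient.mk I (y i), isReduction_of_le_sup hle (s := s) ?_⟩
    rw [← map_pow_le_iff, hmap, map_span_range] at hs
    exact hs.trans le_sup_left

theorem spread_quotient_eq {I J : Ideal R} [IsLocalRing (R ⧸ I)] [IsLocalRing (R ⧸ J)]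
    (hIJ : I ≤ J) {n : ℕ} (hJI : J ^ (n + 1) ≤ I) : spread (R ⧸ I) = spread (R ⧸ J) := by
  refine le_antisymm ?_ ?_
  · obtain ⟨x, s, hx, hs⟩ := hasReductionOfLength_quotient_iff.1
      (hasReductionOfLength_spread (A := R ⧸ J))
    have hpow : ∀ k : ℕ, ∃ t, maximalIdeal R ^ (t + 1) ≤
        Ideal.span (Set.range x) * maximalIdeal R ^ t ⊔ J ^ (k + 1) := by
      intro k
      induction k with
      | zero => exact ⟨s, by simpa using hs⟩
      | succ k ih =>
        obtain ⟨t, ht⟩ := ih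
        exact ⟨_, pow_add_le_mul_pow_sup (Ideal.span_le.2 (Set.range_subset_iff.2 hx)) ht hs
          (pow_succ J (k + 1)).ge⟩
    obtain ⟨t, ht⟩ := hpow n
    exact spread_le (hasReductionOfLength_quotient_iff.2
      ⟨x, t, hx, ht.trans (sup_le_sup_left hJI _)⟩)
  · obtain ⟨x, s, hx, hs⟩ := hasReductionOfLength_quotient_iff.1
      (hasReductionOfLength_spread (A := R ⧸ I))
    exact spread_le (hasReductionOfLength_quotient_iff.2
      ⟨x, s, hx, hs.trans (sup_le_sup_left hIJ _)⟩)

theorem locRedNum_quotient_le [Infinite (ResidueField R)] {I : Ideal R} [IsLocalRing (R ⧸ I)]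
    {ℓ : ℕ} (hℓ : spread (R ⧸ I) = ℓ) {x : Fin ℓ → R} (hx : ∀ i, x i ∈ maximalIdeal R) {s : ℕ}
    (hs : maximalIdeal R ^ (s + 1) ≤ Ideal.span (Set.range x) * maximalIdeal R ^ s ⊔ I) :
    locRedNum ((maximalIdeal R).map (Ideal.Quotient.mk I)) ≤ s := by
  subst hℓ
  have := infinite_residueField_quotient I
  have hmap := map_maximalIdeal_of_surjective _ (Ideal.Quotient.mk_surjective (I := I))
  have hle : Ideal.span (Set.range fun i => Ideal.Quotient.mk I (x i)) ≤
      maximalIdeal (R ⧸ I) := by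
    rw [← map_span_range, ← hmap]
    exact Ideal.map_mono (Ideal.span_le.2 (Set.range_subset_iff.2 hx))
  rw [← map_pow_le_iff, hmap, map_span_range] at hs
  rw [hmap]
  exact locRedNum_le_of_spread hle hs

theorem exists_pow_le_of_locRedNum_quotient [Infinite (ResidueField R)] (I : Ideal R)
    [IsLocalRing (R ⧸ I)] {ℓ : ℕ} (hℓ : spread (R ⧸ I) = ℓ) :
    ∃ x : Fin ℓ → R, (∀ i, x i ∈ maximalIdeal R) ∧
      maximalIdeal R ^ (locRedNum ((maximalIdeal R).map (Ideal.Quotient.mk I)) + 1) ≤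
        Ideal.span (Set.range x) *
          maximalIdeal R ^ locRedNum ((maximalIdeal R).map (Ideal.Quotient.mk I)) ⊔ I := by
  subst hℓ
  have := infinite_residueField_quotient I
  have := IsLocalHom.of_surjective (Ideal.Quotient.mk I) Ideal.Quotient.mk_surjective
  have hmap := map_maximalIdeal_of_surjective _ (Ideal.Quotient.mk_surjective (I := I))
  obtain ⟨x, hx, hs⟩ := exists_span_of_locRedNum (R ⧸ I)
  choose y hy using fun i => Ideal.Quotient.mk_surjective (x i)
  refine ⟨y, fun i => ?_, ?_⟩
  · rw [← maximalIdeal_comap (Ideal.Quotient.mk I), Ideal.mem_comap, hy]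
    exact hx (Ideal.subset_span ⟨i, rfl⟩)
  · rw [← map_pow_le_iff, map_span_range]
    simp only [hy]
    rw [hmap]
    exact hs.le

theorem locRedNum_eq_zero_of_subsingleton {A : Type} [CommRing A] [Subsingleton A] (M : Ideal A) :
    locRedNum M = 0 := by
  have hidx : redIdx M ⊥ = 0 := Nat.sInf_eq_zero.2 (Or.inl (Subsingleton.elim _ _))
  exact Nat.sInf_eq_zero.2 (Or.inl ⟨⊥, ⟨⟨bot_le, 0, Subsingleton.elim _ _⟩,
    fun _ _ _ => Subsingleton.elim _ _⟩, hidx⟩)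

theorem locRedNum_quotient_add_le [Infinite (ResidueField R)] {I J K : Ideal R} {n : ℕ}
    (hI : I ≠ ⊤) (hJ : J ≠ ⊤) (hKI : K ≤ I) (hKJ : K ≤ J) (hIK : I ^ (n + 1) ≤ K)
    (hJK : J ^ (n + 1) ≤ K) (hIJ : I * J ≤ K) :
    locRedNum ((maximalIdeal R).map (Ideal.Quotient.mk K)) ≤
      locRedNum ((maximalIdeal R).map (Ideal.Quotient.mk I)) +
        locRedNum ((maximalIdeal R).map (Ideal.Quotient.mk J)) + 1 := by
  have loc : ∀ L : Ideal R, L ≠ ⊤ → IsLocalRing (R ⧸ L) := fun L hL =>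
    have := Ideal.Quotient.nontrivial_iff.2 hL
    IsLocalRing.of_surjective' (Ideal.Quotient.mk L) Ideal.Quotient.mk_surjective
  have := loc I hI
  have := loc J hJ
  have := loc K fun h => hI (top_le_iff.1 (h ▸ hKI))
  have hsI : spread (R ⧸ I) = spread (R ⧸ K) := (spread_quotient_eq hKI hIK).symm
  have hsJ : spread (R ⧸ J) = spread (R ⧸ K) := (spread_quotient_eq hKJ hJK).symm
  obtain ⟨x, hxm, hx⟩ := exists_pow_le_of_locRedNum_quotient I hsI
  obtain ⟨y, hym, hy⟩ := exists_pow_le_of_locRedNum_quotient J hsJ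
  obtain ⟨z, hzm, hzI, hzJ⟩ := exists_common_pow_le hxm hym hx hy
  exact locRedNum_quotient_le rfl hzm
    (pow_add_le_mul_pow_sup (Ideal.span_le.2 (Set.range_subset_iff.2 hzm)) hzI hzJ hIJ)

/-- The sequence `r(R/Iₙ) + 1` of a filtration is subadditive. -/
theorem subadditive_locRedNum_add_one [Infinite (ResidueField R)] (I : ℕ → Ideal R)
    (hdec : ∀ n, I (n + 1) ≤ I n) (hfil : ∀ a b, I a * I b ≤ I (a + b)) :
    Subadditive fun n =>
      (locRedNum ((maximalIdeal R).map (Ideal.Quotient.mk (I n))) : ℝ) + 1 := by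
  have hanti : Antitone I := antitone_nat_of_succ_le hdec
  have hpow : ∀ n, I 1 ^ (n + 1) ≤ I (n + 1) := by
    intro n
    induction n with
    | zero => simp
    | succ n ih => exact (pow_succ (I 1) (n + 1)).le.trans ((Ideal.mul_mono_left ih).trans (hfil _ _))
  intro a b
  rcases Nat.eq_zero_or_pos a with rfl | ha
  · rw [zero_add]
    exact le_add_of_nonneg_left (by positivity)
  rcases Nat.eq_zero_or_pos b with rfl | hb
  · rw [add_zero]
    exact le_add_of_nonneg_right (by positivity)
  by_cases h1 : I 1 = ⊤
  · have htop : I (a + b) = ⊤ := by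
      obtain ⟨n, hn⟩ : ∃ n, a + b = n + 1 := ⟨a + b - 1, by omega⟩
      simpa [h1, hn, Ideal.top_pow] using hpow n
    have := Ideal.Quotient.subsingleton_iff.2 htop
    simp only [locRedNum_eq_zero_of_subsingleton]
    rw [Nat.cast_zero, zero_add, add_right_comm]
    exact le_add_of_nonneg_left (by positivity)
  have hne : ∀ n, 0 < n → I n ≠ ⊤ := fun n hn h => h1 (top_le_iff.1 (h ▸ hanti hn))
  have hle : ∀ n, 0 < n → I n ^ (a + b + 1) ≤ I (a + b) := fun n hn =>
    (Ideal.pow_right_mono (hanti hn) _).trans ((hpow _).trans (hdec _))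
  have key := locRedNum_quotient_add_le (hne a ha) (hne b hb) (hanti (Nat.le_add_right a b))
    (hanti (Nat.le_add_left b a)) (hle a ha) (hle b hb) (hfil a b)
  have key' : (locRedNum ((maximalIdeal R).map (Ideal.Quotient.mk (I (a + b)))) : ℝ) ≤
      locRedNum ((maximalIdeal R).map (Ideal.Quotient.mk (I a))) +
        locRedNum ((maximalIdeal R).map (Ideal.Quotient.mk (I b))) + 1 := by
    exact_mod_cast key
  linarith

end Quotient

end CMReg

/-- Let `(R, m)` be a (Noetherian) local ring with infinite residue
field and let `{Iₙ}` be a filtration of ideals of `R` with `dim R/Iₙ = dim R/I₁` for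
all `n ≥ 1`.  Then `c = limₙ r(R/Iₙ)/n` exists and `r(R/Iₙ) ≥ c·n − 1` for all
`n ≥ 1`. -/
theorem statement_5 {R : Type} [CommRing R] [IsLocalRing R] [IsNoetherianRing R]
    [Infinite (ResidueField R)] (I : ℕ → Ideal R)
    (hI0 : I 0 = ⊤) (hdec : ∀ n, I (n + 1) ≤ I n)
    (hfil : ∀ a b, I a * I b ≤ I (a + b))
    (hdim : ∀ n ≥ 1, ringKrullDim (R ⧸ I n) = ringKrullDim (R ⧸ I 1)) :
    ∃ c : ℝ,
      Tendsto (fun n : ℕ =>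
          (locRedNum ((maximalIdeal R).map (Ideal.Quotient.mk (I n))) : ℝ) / n)
        atTop (𝓝 c) ∧
      ∀ n : ℕ, 1 ≤ n →
        c * n - 1 ≤ (locRedNum ((maximalIdeal R).map (Ideal.Quotient.mk (I n))) : ℝ) := by
  have hsub := subadditive_locRedNum_add_one I hdec hfil
  have hbdd : BddBelow (Set.range fun n : ℕ =>
      ((locRedNum ((maximalIdeal R).map (Ideal.Quotient.mk (I n))) : ℝ) + 1) / n) :=
    ⟨0, by rintro _ ⟨n, rfl⟩; positivity⟩
  refine ⟨hsub.lim, ?_, fun n hn => ?_⟩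
  · have h := (hsub.tendsto_lim hbdd).sub tendsto_one_div_atTop_nhds_zero_nat
    rw [sub_zero] at h
    refine h.congr fun n => ?_
    rw [← sub_div, add_sub_cancel_right]
  · have h := hsub.lim_le_div hbdd (by omega : n ≠ 0)
    rw [le_div_iff₀ (by exact_mod_cast hn)] at h
    linarith
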